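/- For every j ∈ ℕ with j < |S|, the three vector spaces V₁^j, V₂^j and V₃^j are equal. -/

import Mathlib

open Matrix

/-- A labelled Markov decision process: a partial probabilistic transition function
`phi : S × A ⇀ (S → ℝ)` and a labelling function. -/
structure MDP (S A L : Type) where
  phi : S → A → Option (S → ℝ)
  label : S → L

namespace MDP

variable {S A L : Type} [Fintype S] [Fintype A] [DecidableEq S]

/-- The MDP data is well-formed: every state has an available action, and every
defined `phi s m` is a probability distribution on `S`. -/
def IsValid (D : MDP S A L) : Prop :=
  (∀ s, ∃ m, (D.phi s m).isSome) ∧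
    ∀ s m d, D.phi s m = some d → (∀ t, 0 ≤ d t) ∧ (∑ t, d t) = 1

/-- Transition probabilities, with `0` for unavailable actions. -/
def trans (D : MDP S A L) (s : S) (m : A) : S → ℝ :=
  (D.phi s m).getD 0

/-- A memoryless strategy: for each state a probability distribution on the
available actions. -/
def IsStrategy (D : MDP S A L) (α : S → A → ℝ) : Prop :=
  ∀ s, (∀ m, 0 ≤ α s m) ∧ (∑ m, α s m) = 1 ∧ ∀ m, D.phi s m = none → α s m = 0

/-- Transition probabilities of the induced labelled Markov chain `D(α)`. -/
def tau (D : MDP S A L) (α : S → A → ℝ) (s t : S) : ℝ :=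
  ∑ m, α s m * D.trans s m t

/-- The matrix `M_α(a)`. -/
def Mmat [DecidableEq L] (D : MDP S A L) (α : S → A → ℝ) (a : L) : Matrix S S ℝ :=
  Matrix.of fun s t => if D.label s = a then D.tau α s t else 0

/-- The matrix `M_α(w)` for a word `w ∈ L*` (identity for the empty word). -/
def Mword [DecidableEq L] (D : MDP S A L) (α : S → A → ℝ) (w : List L) : Matrix S S ℝ :=
  (w.map (D.Mmat α)).prod

/-- A memoryless deterministic (MD) strategy, viewed as a function `S → A`
choosing an available action in each state. -/
def IsMD (D : MDP S A L) (β : S → A) : Prop := ∀ s, (D.phi s (β s)).isSome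

/-- The memoryless strategy corresponding to an MD strategy. -/
def mdStrat [DecidableEq A] (β : S → A) : S → A → ℝ :=
  fun s m => if m = β s then 1 else 0

end MDP

namespace MDP

variable {S A L : Type} [Fintype S] [Fintype A] [Fintype L]
  [DecidableEq S] [DecidableEq A] [DecidableEq L]

/-- The column-vector space
`V₁^j = span{M_{α₁}(a₁)⋯M_{α_k}(a_k)·1 : k ≤ j, αᵢ memoryless strategies, aᵢ ∈ L}`. -/
def V1le (D : MDP S A L) (j : ℕ) : Submodule ℝ (S → ℝ) :=
  Submodule.span ℝ
    {v | ∃ k : ℕ, k ≤ j ∧ ∃ (αs : Fin k → S → A → ℝ) (as : Fin k → L),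
      (∀ i, D.IsStrategy (αs i)) ∧
      v = ((List.ofFn fun i => D.Mmat (αs i) (as i)).prod).mulVec 1}

end MDP

namespace MDP

variable {S A L : Type} [Fintype S] [Fintype A] [Fintype L]
  [DecidableEq S] [DecidableEq A] [DecidableEq L]

/-- `V₂^j = span{M_α(w)·1 : α a memoryless strategy, w ∈ L*, |w| ≤ j}`. -/
def V2le (D : MDP S A L) (j : ℕ) : Submodule ℝ (S → ℝ) :=
  Submodule.span ℝ
    {v | ∃ α, D.IsStrategy α ∧ ∃ w : List L, w.length ≤ j ∧ v = (D.Mword α w).mulVec 1}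

/-- `V₃^j = span{M_α(w)·1 : α an MD strategy, w ∈ L*, |w| ≤ j}`. -/
def V3le (D : MDP S A L) (j : ℕ) : Submodule ℝ (S → ℝ) :=
  Submodule.span ℝ
    {v | ∃ β : S → A, D.IsMD β ∧ ∃ w : List L, w.length ≤ j ∧
      v = (D.Mword (mdStrat β) w).mulVec 1}

end MDP

namespace MDP

variable {S A L : Type} [Fintype S] [Fintype A] [Fintype L]
  [DecidableEq S] [DecidableEq A] [DecidableEq L]

omit [Fintype L] [DecidableEq S] [DecidableEq A] in
theorem Mmat_mulVec_apply (D : MDP S A L) (α : S → A → ℝ) (a : L) (x : S → ℝ) (s : S) :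
    (D.Mmat α a).mulVec x s =
      if D.label s = a then ∑ m, α s m * (D.trans s m ⬝ᵥ x) else 0 := by
  unfold Matrix.mulVec Mmat tau dotProduct
  split_ifs with h
  · simp only [Matrix.of_apply, h, if_true, Finset.sum_mul, Finset.mul_sum, mul_assoc]
    exact Finset.sum_comm
  · simp [h]

omit [Fintype L] [DecidableEq S] in
theorem Mmat_mdStrat_mulVec_apply (D : MDP S A L) (β : S → A) (a : L) (x : S → ℝ) (s : S) :
    (D.Mmat (mdStrat β) a).mulVec x s =
      if D.label s = a then D.trans s (β s) ⬝ᵥ x else 0 := by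
  simp [Mmat_mulVec_apply, mdStrat]

omit [Fintype L] [DecidableEq A] in
theorem Mword_cons_mulVec (D : MDP S A L) (α : S → A → ℝ) (a : L) (w : List L) (x : S → ℝ) :
    (D.Mword α (a :: w)).mulVec x = (D.Mmat α a).mulVec ((D.Mword α w).mulVec x) := by
  simp [Mword, Matrix.mulVec_mulVec]

omit [Fintype S] [Fintype A] [Fintype L] [DecidableEq A] [DecidableEq L] in
theorem IsMD.update {D : MDP S A L} {β : S → A} (hβ : D.IsMD β) {s : S} {m : A}
    (hm : (D.phi s m).isSome) : D.IsMD (Function.update β s m) := by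
  intro t
  by_cases h : t = s
  · subst h; simpa using hm
  · simpa [h] using hβ t

omit [Fintype S] [Fintype L] [DecidableEq S] [DecidableEq L] in
theorem IsMD.isStrategy_mdStrat {D : MDP S A L} {β : S → A} (hβ : D.IsMD β) :
    D.IsStrategy (mdStrat β) := by
  refine fun s => ⟨fun m => ?_, by simp [mdStrat], fun m hm => ?_⟩
  · unfold mdStrat; split_ifs <;> norm_num
  · have : m ≠ β s := by
      rintro rfl
      simpa [hm] using hβ s
    simp [mdStrat, this]

omit [Fintype L] in
/-- Changing an MD strategy at the single state `s` changes only the entry at `s`. -/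
theorem Mmat_update_mulVec_sub (D : MDP S A L) (β : S → A) (s : S) (m : A) (a : L) (x : S → ℝ) :
    (D.Mmat (mdStrat (Function.update β s m)) a).mulVec x - (D.Mmat (mdStrat β) a).mulVec x =
      Pi.single s (if D.label s = a then D.trans s m ⬝ᵥ x - D.trans s (β s) ⬝ᵥ x else 0) := by
  ext t
  rw [Pi.sub_apply, Mmat_mdStrat_mulVec_apply, Mmat_mdStrat_mulVec_apply]
  by_cases h : t = s
  · subst h
    by_cases ha : D.label t = a <;> simp [ha]
  · simp [h]

omit [Fintype L] in
/-- A submodule containing `M_β(a) x` for all MD strategies `β` contains it for all memoryless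
strategies. -/
theorem Mmat_mulVec_mem_of_forall_isMD {D : MDP S A L} (hD : D.IsValid) {W : Submodule ℝ (S → ℝ)}
    {a : L} {x : S → ℝ}
    (hW : ∀ β, D.IsMD β → (D.Mmat (mdStrat β) a).mulVec x ∈ W)
    {α : S → A → ℝ} (hα : D.IsStrategy α) : (D.Mmat α a).mulVec x ∈ W := by
  choose β hβ using hD.1
  have key : (D.Mmat α a).mulVec x = (D.Mmat (mdStrat β) a).mulVec x +
      ∑ s, ∑ m, α s m • ((D.Mmat (mdStrat (Function.update β s m)) a).mulVec x -
        (D.Mmat (mdStrat β) a).mulVec x) := by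
    ext t
    simp only [Mmat_update_mulVec_sub, Pi.add_apply, Finset.sum_apply, Pi.smul_apply, smul_eq_mul]
    rw [Finset.sum_eq_single t (fun s _ hs => by simp [hs.symm]) (by simp)]
    rw [Mmat_mulVec_apply, Mmat_mdStrat_mulVec_apply]
    by_cases ha : D.label t = a
    · simp [ha, mul_sub, Finset.sum_sub_distrib, ← Finset.sum_mul, (hα t).2.1]
    · simp [ha]
  rw [key]
  refine W.add_mem (hW β hβ) (W.sum_mem fun s _ => W.sum_mem fun m _ => ?_)
  cases h : D.phi s m with
  | none => simp [(hα s).2.2 m h]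
  | some d =>
    exact W.smul_mem _ (W.sub_mem (hW _ (IsMD.update hβ (by simp [h]))) (hW β hβ))

omit [Fintype L] in
theorem V3le_mono (D : MDP S A L) : Monotone D.V3le := by
  intro i j h
  refine Submodule.span_mono ?_
  rintro v ⟨β, hβ, w, hw, rfl⟩
  exact ⟨β, hβ, w, hw.trans h, rfl⟩

omit [Fintype L] in
theorem Mword_mulVec_one_mem_V3le {D : MDP S A L} {β : S → A} (hβ : D.IsMD β) (w : List L) :
    (D.Mword (mdStrat β) w).mulVec 1 ∈ D.V3le w.length :=
  Submodule.subset_span ⟨β, hβ, w, le_rfl, rfl⟩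

omit [Fintype L] in
/-- If `e_s ∉ V₃^{i+1}`, then all actions at `s` act equally on `V₃^i`. -/
theorem trans_dotProduct_eq_of_single_notMem {D : MDP S A L} {i : ℕ}
    (hstep : ∀ β, D.IsMD β → ∀ a, ∀ x ∈ D.V3le i, (D.Mmat (mdStrat β) a).mulVec x ∈ D.V3le (i + 1))
    {s : S} (hs : Pi.single s 1 ∉ D.V3le (i + 1)) {β : S → A} (hβ : D.IsMD β) {m : A}
    (hm : (D.phi s m).isSome) {x : S → ℝ} (hx : x ∈ D.V3le i) :
    D.trans s m ⬝ᵥ x = D.trans s (β s) ⬝ᵥ x := by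
  by_contra hne
  have hmem := (D.V3le (i + 1)).sub_mem (hstep _ (hβ.update hm) (D.label s) x hx)
    (hstep β hβ (D.label s) x hx)
  rw [Mmat_update_mulVec_sub, if_pos rfl] at hmem
  refine hs ?_
  have h := (D.V3le (i + 1)).smul_mem (D.trans s m ⬝ᵥ x - D.trans s (β s) ⬝ᵥ x)⁻¹ hmem
  rwa [← Pi.single_smul, smul_eq_mul, inv_mul_cancel₀ (sub_ne_zero.2 hne)] at h

omit [Fintype L] in
/-- MD strategies agreeing on the states `s` with `e_s ∈ V₃^j` induce the same vectors for words
of length at most `j`. -/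
theorem Mword_mulVec_one_eq {D : MDP S A L} {j : ℕ}
    (hstep : ∀ i < j, ∀ β, D.IsMD β → ∀ a, ∀ x ∈ D.V3le i,
      (D.Mmat (mdStrat β) a).mulVec x ∈ D.V3le (i + 1))
    {β γ : S → A} (hβ : D.IsMD β) (hγ : D.IsMD γ)
    (hagree : ∀ s, Pi.single s 1 ∈ D.V3le j → β s = γ s) (w : List L) (hw : w.length ≤ j) :
    (D.Mword (mdStrat β) w).mulVec 1 = (D.Mword (mdStrat γ) w).mulVec 1 := by
  induction w with
  | nil => simp [Mword]
  | cons a w ih =>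
    rw [List.length_cons] at hw
    rw [Mword_cons_mulVec, Mword_cons_mulVec, ih (by lia)]
    ext s
    rw [Mmat_mdStrat_mulVec_apply, Mmat_mdStrat_mulVec_apply]
    by_cases hs : Pi.single s 1 ∈ D.V3le j
    · rw [hagree s hs]
    · rw [trans_dotProduct_eq_of_single_notMem (hstep w.length (by lia))
        (fun h => hs (D.V3le_mono hw h)) hγ (hβ s) (Mword_mulVec_one_mem_V3le hγ w)]

omit [Fintype L] in
theorem Mmat_mdStrat_mulVec_mem_V3le (D : MDP S A L) (j : ℕ) :
    ∀ β, D.IsMD β → ∀ a, ∀ x ∈ D.V3le j, (D.Mmat (mdStrat β) a).mulVec x ∈ D.V3le (j + 1) := by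
  classical
  induction j using Nat.strong_induction_on with
  | _ j hstep =>
  intro β hβ a x hx
  induction hx using Submodule.span_induction with
  | zero => simp
  | add x y _ _ hx hy => rw [Matrix.mulVec_add]; exact Submodule.add_mem _ hx hy
  | smul c x _ hx => rw [Matrix.mulVec_smul]; exact Submodule.smul_mem _ c hx
  | mem x hx =>
    obtain ⟨γ, hγ, w, hw, rfl⟩ := hx
    let δ : S → A := fun s => if Pi.single s 1 ∈ D.V3le j then γ s else β s
    have hδ : D.IsMD δ := by
      intro s
      by_cases h : Pi.single s 1 ∈ D.V3le j
      · simpa only [δ, if_pos h] using hγ s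
      · simpa only [δ, if_neg h] using hβ s
    rw [← Mword_mulVec_one_eq hstep hδ hγ (fun s hs => if_pos hs) w hw]
    set y := (D.Mword (mdStrat δ) w).mulVec 1 with hy
    have hmem : (D.Mmat (mdStrat δ) a).mulVec y ∈ D.V3le (j + 1) := by
      rw [hy, ← Mword_cons_mulVec]
      exact D.V3le_mono (by simpa using hw) (Mword_mulVec_one_mem_V3le hδ (a :: w))
    have hdiff : (D.Mmat (mdStrat β) a).mulVec y - (D.Mmat (mdStrat δ) a).mulVec y ∈
        D.V3le (j + 1) := by
      rw [pi_eq_sum_univ' ((D.Mmat (mdStrat β) a).mulVec y - (D.Mmat (mdStrat δ) a).mulVec y)]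
      refine Submodule.sum_mem _ fun s _ => ?_
      by_cases h : Pi.single s 1 ∈ D.V3le j
      · refine Submodule.smul_mem _ _ ?_
        convert D.V3le_mono j.le_succ h
      · rw [Pi.sub_apply, Mmat_mdStrat_mulVec_apply, Mmat_mdStrat_mulVec_apply]
        simp only [δ, if_neg h, sub_self, zero_smul, Submodule.zero_mem]
    simpa using Submodule.add_mem _ hdiff hmem

omit [Fintype L] in
theorem V1le_le_V3le {D : MDP S A L} (hD : D.IsValid) (j : ℕ) : D.V1le j ≤ D.V3le j := by
  refine Submodule.span_le.2 ?_
  rintro v ⟨k, hk, αs, as, hα, rfl⟩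
  refine D.V3le_mono hk ?_
  clear hk
  induction k with
  | zero =>
    choose β hβ using hD.1
    simpa [Mword] using Mword_mulVec_one_mem_V3le (D := D) (β := β) hβ []
  | succ k ih =>
    rw [List.ofFn_succ, List.prod_cons, ← Matrix.mulVec_mulVec]
    exact Mmat_mulVec_mem_of_forall_isMD hD
      (fun β hβ => D.Mmat_mdStrat_mulVec_mem_V3le k β hβ _ _
        (ih (fun i => αs i.succ) (fun i => as i.succ) fun i => hα i.succ)) (hα 0)

omit [Fintype L] [DecidableEq A] in
theorem V2le_le_V1le (D : MDP S A L) (j : ℕ) : D.V2le j ≤ D.V1le j := by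
  refine Submodule.span_mono ?_
  rintro v ⟨α, hα, w, hw, rfl⟩
  refine ⟨w.length, hw, fun _ => α, w.get, fun _ => hα, ?_⟩
  have h : (List.ofFn fun i => D.Mmat α (w.get i)) = w.map (D.Mmat α) := by
    simp [← Function.comp_def, ← List.map_ofFn]
  rw [h, Mword]

omit [Fintype L] in
theorem V3le_le_V2le (D : MDP S A L) (j : ℕ) : D.V3le j ≤ D.V2le j := by
  refine Submodule.span_mono ?_
  rintro v ⟨β, hβ, w, hw, rfl⟩
  exact ⟨mdStrat β, hβ.isStrategy_mdStrat, w, hw, rfl⟩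

/-- for every `j < |S|`, the vector spaces `V₁^j`, `V₂^j` and `V₃^j`
are equal. -/
theorem v1le_eq_v2le_eq_v3le
    (D : MDP S A L) (hD : D.IsValid) (j : ℕ) (hj : j < Fintype.card S) :
    D.V1le j = D.V2le j ∧ D.V2le j = D.V3le j := by
  have h13 := V1le_le_V3le hD j
  have h21 := D.V2le_le_V1le j
  have h32 := D.V3le_le_V2le j
  exact ⟨le_antisymm (h13.trans h32) h21, le_antisymm (h21.trans h13) h32⟩

end MDP
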